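/- arXiv:2409.12749 — 6 statements merged into one kernel-verified Lean document; each statement's English description precedes it below -/
import Mathlib

section
/- The measure μ, defined as the pushforward under D of Lebesgue measure restricted to [0,1] (the Cantor distribution), is mutually singular with Lebesgue measure on ℝ: μ ⟂ λ. In particular μ has no probability density function with respect to Lebesgue measure. -/
open MeasureTheory

/-- The `n`-th binary digit of `y ∈ [0,1]`: `b_n(y) = ⌊2^n y⌋ − 2⌊2^(n−1) y⌋`. -/
noncomputable def binDigit (n : ℕ) (y : ℝ) : ℤ :=
  ⌊(2 : ℝ) ^ n * y⌋ - 2 * ⌊(2 : ℝ) ^ (n - 1) * y⌋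

/-- The map `D(y) = ∑_{n=1}^∞ 2·b_n(y)/3^n`. -/
noncomputable def cantorD (y : ℝ) : ℝ :=
  ∑' n : ℕ, 2 * (binDigit (n + 1) y : ℝ) / 3 ^ (n + 1)

/-- The Cantor distribution: the pushforward under `D` of Lebesgue measure on `[0,1]`. -/
noncomputable def cantorMeasure : Measure ℝ :=
  Measure.map cantorD (volume.restrict (Set.Icc (0 : ℝ) 1))

/-- The middle-thirds Cantor set is Lebesgue null. -/
theorem volume_cantorSet : volume cantorSet = 0 := by
  have hfin : volume cantorSet ≠ ⊤ := isCompact_cantorSet.measure_ne_top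
  have himage (c : ℝ) :
      volume ((fun x : ℝ ↦ (c + x) / 3) '' cantorSet) = ENNReal.ofReal 3⁻¹ * volume cantorSet := by
    have h : (fun x : ℝ ↦ (c + x) / 3) = AffineMap.homothety (c / 2) (3⁻¹ : ℝ) := by
      ext x
      simp [AffineMap.homothety_apply]
      ring
    rw [h, Measure.addHaar_image_homothety]
    simp
  have hle : volume cantorSet ≤
      ENNReal.ofReal 3⁻¹ * volume cantorSet + ENNReal.ofReal 3⁻¹ * volume cantorSet := by
    conv_lhs => rw [cantorSet_eq_union_halves]
    refine (measure_union_le _ _).trans_eq ?_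
    rw [himage 2, ← himage 0]
    simp
  lift volume cantorSet to NNReal using hfin with v
  have hle' := ENNReal.toReal_mono (by finiteness) hle
  rw [ENNReal.toReal_add (by finiteness) (by finiteness)] at hle'
  norm_num [ENNReal.toReal_mul] at hle'
  have hv := v.coe_nonneg
  have : (v : ℝ) = 0 := by linarith
  exact_mod_cast this

theorem binDigit_succ_eq_zero_or_one (n : ℕ) (y : ℝ) :
    binDigit (n + 1) y = 0 ∨ binDigit (n + 1) y = 1 := by
  have h : (2 : ℝ) ^ (n + 1) * y = 2 * (2 ^ n * y) := by ring
  simp only [binDigit, Nat.add_sub_cancel, h]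
  generalize (2 : ℝ) ^ n * y = z
  have h₁ : 2 * ⌊z⌋ ≤ ⌊2 * z⌋ := by
    rw [Int.le_floor]
    push_cast
    linarith [Int.floor_le z]
  have h₂ : ⌊2 * z⌋ < 2 * ⌊z⌋ + 2 := by
    rw [Int.floor_lt]
    push_cast
    linarith [Int.lt_floor_add_one z]
  omega

theorem cantorD_mem_cantorSet (y : ℝ) : cantorD y ∈ cantorSet := by
  have h : cantorD y =
      Real.ofDigits fun n ↦ if binDigit (n + 1) y = 0 then (0 : Fin 3) else 2 := by
    refine tsum_congr fun n ↦ ?_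
    rcases binDigit_succ_eq_zero_or_one n y with h | h <;>
      simp [h, Real.ofDigitsTerm, div_eq_mul_inv]
  rw [h]
  refine ofDigits_zero_two_sequence_mem_cantorSet fun n ↦ ?_
  split_ifs <;> decide

/-- The Cantor distribution is mutually singular with Lebesgue measure: `μ ⟂ λ`. -/
theorem cantorMeasure_mutuallySingular : cantorMeasure ⟂ₘ (volume : Measure ℝ) := by
  refine ⟨cantorSetᶜ, isClosed_cantorSet.measurableSet.compl, ?_, by simpa using volume_cantorSet⟩
  by_cases hD : AEMeasurable cantorD (volume.restrict (Set.Icc (0 : ℝ) 1))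
  · rw [cantorMeasure, Measure.map_apply_of_aemeasurable hD isClosed_cantorSet.measurableSet.compl]
    have h : cantorD ⁻¹' cantorSetᶜ = ∅ :=
      Set.eq_empty_of_forall_notMem fun y hy ↦ hy (cantorD_mem_cantorSet y)
    rw [h, measure_empty]
  · simp [cantorMeasure, Measure.map_of_not_aemeasurable hD]
end

section
/- The measure μ, defined as the pushforward under D of Lebesgue measure restricted to [0,1] (the Cantor distribution), has no atoms: μ({x}) = 0 for every x ∈ ℝ. Together with its singularity with respect to Lebesgue measure, this shows μ is a singular continuous distribution. -/
open MeasureTheory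

lemma floor_two_pow_succ_mul (n : ℕ) (y : ℝ) :
    ⌊(2 : ℝ) ^ (n + 1) * y⌋ = 2 * ⌊(2 : ℝ) ^ n * y⌋ + binDigit (n + 1) y := by
  simp [binDigit]

lemma binDigit_succ_nonneg (n : ℕ) (y : ℝ) : 0 ≤ binDigit (n + 1) y := by
  have h : 2 * ⌊(2 : ℝ) ^ n * y⌋ ≤ ⌊(2 : ℝ) ^ (n + 1) * y⌋ := by
    rw [Int.le_floor]
    push_cast
    rw [pow_succ]
    linarith [Int.floor_le ((2 : ℝ) ^ n * y)]
  linarith [floor_two_pow_succ_mul n y]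

lemma binDigit_succ_le_one (n : ℕ) (y : ℝ) : binDigit (n + 1) y ≤ 1 := by
  have h : ⌊(2 : ℝ) ^ (n + 1) * y⌋ < 2 * ⌊(2 : ℝ) ^ n * y⌋ + 2 := by
    rw [Int.floor_lt]
    push_cast
    rw [pow_succ]
    linarith [Int.lt_floor_add_one ((2 : ℝ) ^ n * y)]
  linarith [floor_two_pow_succ_mul n y]

lemma binDigit_add_succ (m n : ℕ) (y : ℝ) :
    binDigit (m + n + 1) y = binDigit (n + 1) (2 ^ m * y) := by
  simp only [binDigit, Nat.add_sub_cancel]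
  rw [← mul_assoc, ← mul_assoc, ← pow_add, ← pow_add, add_comm m n, add_right_comm n m 1]

lemma hasSum_two_div_three_pow_succ : HasSum (fun n : ℕ => (2 : ℝ) / 3 ^ (n + 1)) 1 := by
  have h := (hasSum_geometric_of_lt_one (r := (1 / 3 : ℝ)) (by norm_num) (by norm_num)).mul_left
    (2 / 3)
  have h1 : (2 / 3 : ℝ) * (1 - 1 / 3)⁻¹ = 1 := by norm_num
  rw [h1] at h
  have hterm (n : ℕ) : (2 : ℝ) / 3 ^ (n + 1) = 2 / 3 * (1 / 3) ^ n := by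
    rw [pow_succ, one_div_pow]
    field_simp
  simpa only [hterm] using h

lemma cantorD_term_nonneg (y : ℝ) (n : ℕ) :
    0 ≤ 2 * (binDigit (n + 1) y : ℝ) / 3 ^ (n + 1) := by
  have : (0 : ℝ) ≤ binDigit (n + 1) y := by exact_mod_cast binDigit_succ_nonneg n y
  positivity

lemma cantorD_term_le (y : ℝ) (n : ℕ) :
    2 * (binDigit (n + 1) y : ℝ) / 3 ^ (n + 1) ≤ 2 / 3 ^ (n + 1) := by
  have : (binDigit (n + 1) y : ℝ) ≤ 1 := by exact_mod_cast binDigit_succ_le_one n y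
  gcongr
  linarith

lemma summable_cantorD (y : ℝ) :
    Summable fun n : ℕ => 2 * (binDigit (n + 1) y : ℝ) / 3 ^ (n + 1) :=
  .of_nonneg_of_le (cantorD_term_nonneg y) (cantorD_term_le y)
    hasSum_two_div_three_pow_succ.summable

lemma cantorD_nonneg (y : ℝ) : 0 ≤ cantorD y :=
  tsum_nonneg (cantorD_term_nonneg y)

lemma cantorD_le_one (y : ℝ) : cantorD y ≤ 1 :=
  hasSum_le (cantorD_term_le y) (summable_cantorD y).hasSum hasSum_two_div_three_pow_succ

lemma cantorD_eq (y : ℝ) : cantorD y = (2 * binDigit 1 y + cantorD (2 * y)) / 3 := by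
  rw [cantorD, (summable_cantorD y).tsum_eq_zero_add, cantorD, add_div, ← tsum_div_const]
  congr 1
  · norm_num
  · refine tsum_congr fun n => ?_
    have h := binDigit_add_succ 1 n y
    rw [pow_one, add_comm 1 n] at h
    rw [h, pow_succ (3 : ℝ) (n + 1), div_div]

lemma binDigit_one_eq_of_cantorD_eq {y z : ℝ} (h : cantorD y = cantorD z) :
    binDigit 1 y = binDigit 1 z := by
  rw [cantorD_eq y, cantorD_eq z] at h
  have hlt : ∀ a b : ℤ, (2 * a + cantorD (2 * y)) / 3 = (2 * b + cantorD (2 * z)) / 3 →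
      a < b + 1 ∧ b < a + 1 := by
    intro a b hab
    have h1 := cantorD_nonneg (2 * y)
    have h2 := cantorD_le_one (2 * y)
    have h3 := cantorD_nonneg (2 * z)
    have h4 := cantorD_le_one (2 * z)
    constructor <;> rify <;> linarith
  have := hlt _ _ h
  omega

lemma cantorD_two_pow_mul_eq {y z : ℝ} (h : cantorD y = cantorD z) (n : ℕ) :
    cantorD (2 ^ n * y) = cantorD (2 ^ n * z) := by
  induction n with
  | zero => simpa using h
  | succ n ih =>
    have hb := binDigit_one_eq_of_cantorD_eq ih
    rw [cantorD_eq (2 ^ n * y), cantorD_eq (2 ^ n * z), hb] at ih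
    rw [pow_succ', mul_assoc, mul_assoc]
    linarith

/-- `cantorD` separates points with the same integer part. -/
lemma eq_of_cantorD_eq_of_floor_eq {y z : ℝ} (h : cantorD y = cantorD z) (hf : ⌊y⌋ = ⌊z⌋) :
    y = z := by
  have hfloor : ∀ n : ℕ, ⌊(2 : ℝ) ^ n * y⌋ = ⌊(2 : ℝ) ^ n * z⌋ := by
    intro n
    induction n with
    | zero => simpa using hf
    | succ n ih =>
      rw [floor_two_pow_succ_mul, floor_two_pow_succ_mul, ih]
      have hb := binDigit_one_eq_of_cantorD_eq (cantorD_two_pow_mul_eq h n)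
      have hy := binDigit_add_succ n 0 y
      have hz := binDigit_add_succ n 0 z
      simp only [add_zero, zero_add] at hy hz
      rw [hy, hz, hb]
  by_contra hne
  have hpos : 0 < |y - z| := abs_pos.mpr (sub_ne_zero.mpr hne)
  obtain ⟨n, hn⟩ := pow_unbounded_of_one_lt (1 / |y - z|) (one_lt_two (α := ℝ))
  have hlt := Int.abs_sub_lt_one_of_floor_eq_floor (hfloor n)
  rw [← mul_sub, abs_mul, abs_of_pos (by positivity : (0 : ℝ) < 2 ^ n)] at hlt
  rw [div_lt_iff₀ hpos] at hn
  linarith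

lemma injOn_cantorD_Ico : Set.InjOn cantorD (Set.Ico 0 1) := fun _ hy _ hz h =>
  eq_of_cantorD_eq_of_floor_eq h <| by
    rw [Int.floor_eq_zero_iff.mpr hy, Int.floor_eq_zero_iff.mpr hz]

/-- The Cantor distribution has no atoms: `μ({x}) = 0` for every `x ∈ ℝ`. -/
theorem cantorMeasure_no_atoms (x : ℝ) : cantorMeasure {x} = 0 := by
  rw [cantorMeasure, ← Measure.restrict_congr_set (Ico_ae_eq_Icc (μ := volume) (a := (0 : ℝ)) (b := 1))]
  by_cases hD : AEMeasurable cantorD (volume.restrict (Set.Ico (0 : ℝ) 1))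
  · rw [Measure.map_apply_of_aemeasurable hD (measurableSet_singleton x),
      Measure.restrict_apply' measurableSet_Ico]
    refine Set.Subsingleton.measure_zero (fun y hy z hz => ?_) volume
    exact injOn_cantorD_Ico hy.2 hz.2 (hy.1.trans hz.1.symm)
  · simp [Measure.map_of_not_aemeasurable hD]
end

section
/- The topological support of the measure μ, defined as the pushforward under D of Lebesgue measure restricted to [0,1] (the Cantor distribution), is exactly the ternary Cantor set. (Consequently, the spectrum of the bath Hamiltonian H = ∑_{k≥1} I_z^{(k)}/3^k, which is unitarily equivalent to multiplication by x − 1/2 on L²([0,1], μ), is the Cantor set shifted by −1/2.) -/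
open MeasureTheory

/-- The topological support of a measure on `ℝ`: the set of points all of whose open
neighborhoods have positive measure. -/
def measureSupport (μ : Measure ℝ) : Set ℝ :=
  {x : ℝ | ∀ U : Set ℝ, IsOpen U → x ∈ U → 0 < μ U}

theorem measurable_binDigit (n : ℕ) : Measurable (binDigit n) := by
  unfold binDigit
  fun_prop

theorem binDigit_one_half_add {y : ℝ} (hy : y ∈ Set.Ico (0 : ℝ) 1) {b : ℤ}
    (hb : b = 0 ∨ b = 1) : binDigit 1 ((y + b) / 2) = b := by
  obtain ⟨h0, h1⟩ := hy
  have h2 : ⌊(2 : ℝ) ^ 1 * ((y + b) / 2)⌋ = b := by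
    rw [Int.floor_eq_iff]
    constructor <;> linarith
  have h3 : ⌊(2 : ℝ) ^ (1 - 1) * ((y + b) / 2)⌋ = 0 := by
    rw [Int.floor_eq_iff]
    rcases hb with rfl | rfl <;> constructor <;> norm_num <;> linarith
  rw [binDigit, h2, h3]
  ring

theorem binDigit_add_two_half_add (n : ℕ) (y : ℝ) (b : ℤ) :
    binDigit (n + 2) ((y + b) / 2) = binDigit (n + 1) y := by
  have h (k : ℕ) : ⌊(2 : ℝ) ^ (k + 1) * ((y + b) / 2)⌋ = ⌊(2 : ℝ) ^ k * y⌋ + 2 ^ k * b := by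
    rw [← Int.floor_add_intCast]
    congr 1
    push_cast
    ring
  simp only [binDigit, Nat.add_sub_cancel, Nat.add_succ_sub_one, h]
  ring

/-- The ternary digits (all `0` or `2`) of `cantorD y`. -/
noncomputable def cantorDigit (y : ℝ) (n : ℕ) : Fin 3 :=
  if binDigit (n + 1) y = 0 then 0 else 2

theorem cantorDigit_ne_one (y : ℝ) (n : ℕ) : cantorDigit y n ≠ 1 := by
  unfold cantorDigit
  split_ifs <;> decide

theorem measurable_cantorDigit : Measurable cantorDigit := by
  refine measurable_pi_lambda _ fun n ↦ ?_
  exact Measurable.ite (measurable_binDigit (n + 1) (measurableSet_singleton 0))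
    measurable_const measurable_const

theorem cantorD_eq_ofDigits (y : ℝ) : cantorD y = Real.ofDigits (cantorDigit y) := by
  refine tsum_congr fun n ↦ ?_
  rcases binDigit_succ_eq_zero_or_one n y with h | h <;>
    simp [cantorDigit, Real.ofDigitsTerm, h, div_eq_mul_inv]

theorem measurable_cantorD : Measurable cantorD := by
  rw [funext cantorD_eq_ofDigits]
  exact Real.continuous_ofDigits.measurable.comp measurable_cantorDigit

theorem cantorD_half_add {y : ℝ} (hy : y ∈ Set.Ico (0 : ℝ) 1) {b : ℤ} (hb : b = 0 ∨ b = 1) :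
    cantorD ((y + b) / 2) = (2 * b + cantorD y) / 3 := by
  have hshift : (fun i ↦ cantorDigit ((y + b) / 2) (i + 1)) = cantorDigit y := by
    funext i
    simp only [cantorDigit, binDigit_add_two_half_add]
  rw [cantorD_eq_ofDigits, cantorD_eq_ofDigits, Real.ofDigits_eq_sum_add_ofDigits _ 1, hshift]
  rcases hb with rfl | rfl
  · have h := binDigit_one_half_add hy (Or.inl rfl)
    simp [Real.ofDigitsTerm, cantorDigit] at h ⊢
    simp [h]
    ring
  · have h := binDigit_one_half_add hy (Or.inr rfl)
    simp [Real.ofDigitsTerm, cantorDigit] at h ⊢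
    simp [h]
    ring

theorem exists_Ioo_abs_cantorD_sub_le (n : ℕ) {x : ℝ} (hx : x ∈ cantorSet) :
    ∃ c d : ℝ, c < d ∧ Set.Ioo c d ⊆ Set.Ico 0 1 ∧
      ∀ y ∈ Set.Ioo c d, |cantorD y - x| ≤ (1 / 3) ^ n := by
  induction n generalizing x with
  | zero =>
    refine ⟨0, 1, one_pos, Set.Ioo_subset_Ico_self, fun y _ ↦ ?_⟩
    have hx' := cantorSet_subset_unitInterval hx
    have hy' := cantorSet_subset_unitInterval (cantorD_mem_cantorSet y)
    rw [pow_zero, abs_le]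
    constructor <;> linarith [hx'.1, hx'.2, hy'.1, hy'.2]
  | succ n ih =>
    obtain ⟨b, hb, x', hx', rfl⟩ :
        ∃ b : ℤ, (b = 0 ∨ b = 1) ∧ ∃ x' ∈ cantorSet, x = (2 * b + x') / 3 := by
      rw [cantorSet_eq_union_halves] at hx
      rcases hx with ⟨x', hx', rfl⟩ | ⟨x', hx', rfl⟩
      · exact ⟨0, Or.inl rfl, x', hx', by simp⟩
      · exact ⟨1, Or.inr rfl, x', hx', by simp⟩
    obtain ⟨c, d, hcd, hsub, h⟩ := ih hx'
    have key (y : ℝ) (hy : y ∈ Set.Ioo ((c + b) / 2) ((d + b) / 2)) :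
        2 * y - b ∈ Set.Ioo c d := by
      constructor <;> linarith [hy.1, hy.2]
    refine ⟨(c + b) / 2, (d + b) / 2, by linarith, fun y hy ↦ ?_, fun y hy ↦ ?_⟩
    · have hy' := hsub (key y hy)
      rcases hb with rfl | rfl <;> push_cast at hy' <;>
        constructor <;> linarith [hy'.1, hy'.2]
    · have hy' : y = ((2 * y - b) + b) / 2 := by ring
      rw [hy', cantorD_half_add (hsub (key y hy)) hb, ← sub_div, add_sub_add_left_eq_sub, abs_div,
        abs_of_pos (three_pos : (0 : ℝ) < 3), pow_succ]
      linarith [h _ (key y hy)]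

/-- The topological support of the Cantor distribution is exactly the ternary Cantor set. -/
theorem cantorMeasure_support : measureSupport cantorMeasure = cantorSet := by
  ext x
  constructor
  · intro hx
    by_contra hxC
    have h := hx cantorSetᶜ isClosed_cantorSet.isOpen_compl hxC
    have hempty : cantorD ⁻¹' cantorSetᶜ = ∅ :=
      Set.eq_empty_of_forall_notMem fun y hy ↦ hy (cantorD_mem_cantorSet y)
    rw [cantorMeasure, Measure.map_apply measurable_cantorD
      isClosed_cantorSet.measurableSet.compl, hempty, measure_empty] at h
    exact h.false
  · intro hx U hU hxU
    obtain ⟨ε, hε, hball⟩ := Metric.isOpen_iff.mp hU x hxU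
    obtain ⟨n, hn⟩ := exists_pow_lt_of_lt_one hε (by norm_num : (1 / 3 : ℝ) < 1)
    obtain ⟨c, d, hcd, hsub, h⟩ := exists_Ioo_abs_cantorD_sub_le n hx
    rw [cantorMeasure, Measure.map_apply measurable_cantorD hU.measurableSet]
    calc 0 < volume (Set.Ioo c d) := by simpa using hcd
      _ = volume.restrict (Set.Icc (0 : ℝ) 1) (Set.Ioo c d) :=
        (Measure.restrict_eq_self _ (hsub.trans Set.Ico_subset_Icc_self)).symm
      _ ≤ volume.restrict (Set.Icc (0 : ℝ) 1) (cantorD ⁻¹' U) :=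
        measure_mono fun y hy ↦ hball ((h y hy).trans_lt hn)
end

section
/- For every natural number i, F(3^i·π) = (−1)^i · F(π), where F(t) = ∏_{k=1}^∞ cos(t/3^k). -/
open Filter Real

theorem cos_three_pow_mul_pi (i : ℕ) : Real.cos (3 ^ i * π) = -1 := by
  have h : Odd (3 ^ i) := Odd.pow (by decide)
  have := Real.cos_nat_mul_pi (3 ^ i)
  rw [h.neg_one_pow] at this
  exact_mod_cast this

/-- The infinite product satisfies `F(3t) = cos t · F(t)`. -/
theorem dephasing_three_mul (F : ℝ → ℝ)
    (hF : ∀ t : ℝ, Tendsto (fun N : ℕ => ∏ k ∈ Finset.range N, Real.cos (t / 3 ^ (k + 1)))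
      atTop (nhds (F t))) (t : ℝ) : F (3 * t) = Real.cos t * F t := by
  refine tendsto_nhds_unique ((tendsto_add_atTop_iff_nat 1).2 (hF (3 * t))) ?_
  refine ((hF t).const_mul (Real.cos t)).congr fun N => ?_
  have scale (k : ℕ) : 3 * t / 3 ^ (k + 1) = t / 3 ^ k := by
    rw [pow_succ']
    exact mul_div_mul_left _ _ three_ne_zero
  simp only [scale]
  rw [Finset.prod_range_succ', pow_zero, div_one, mul_comm]

/-- For every natural number `i`, `F(3^i·π) = (−1)^i·F(π)`, where
`F(t) = ∏_{k=1}^∞ cos(t/3^k)`. -/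
theorem dephasing_at_three_pow_pi (F : ℝ → ℝ)
    (hF : ∀ t : ℝ, Tendsto (fun N : ℕ => ∏ k ∈ Finset.range N, Real.cos (t / 3 ^ (k + 1)))
      atTop (nhds (F t))) :
    ∀ i : ℕ, F (3 ^ i * π) = (-1 : ℝ) ^ i * F π := by
  intro i
  induction i with
  | zero => simp
  | succ i ih =>
    rw [pow_succ', mul_assoc, dephasing_three_mul F hF, cos_three_pow_mul_pi, ih, pow_succ',
      mul_assoc]
end

section
/- The function F(t) = ∏_{k=1}^∞ cos(t/3^k) has no limit as t → +∞: there is no real number L such that F(t) → L as t → +∞. In particular F(t) does not converge to 0, so the central spin with couplings A_k = 1/3^k never fully dephases and exhibits persistent oscillations. -/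
open Filter Real

theorem prod_cos_div_three_pow_succ (t : ℝ) (N : ℕ) :
    ∏ k ∈ Finset.range (N + 1), Real.cos (t / 3 ^ (k + 1)) =
      Real.cos (t / 3) * ∏ k ∈ Finset.range N, Real.cos (t / 3 / 3 ^ (k + 1)) := by
  rw [Finset.prod_range_succ', mul_comm]
  congr 1
  · simp
  · refine Finset.prod_congr rfl fun k _ => ?_
    rw [div_div, ← pow_succ']

theorem one_sub_sq_div_le_prod_cos (N : ℕ) (t : ℝ) (ht : t ^ 2 ≤ 16) :
    1 - t ^ 2 / 16 ≤ ∏ k ∈ Finset.range N, Real.cos (t / 3 ^ (k + 1)) := by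
  induction N generalizing t with
  | zero =>
    simp only [Finset.range_zero, Finset.prod_empty]
    linarith [sq_nonneg t]
  | succ N ih =>
    rw [prod_cos_div_three_pow_succ]
    have h1 := ih (t / 3) (by nlinarith [sq_nonneg t])
    have h2 := Real.one_sub_sq_div_two_le_cos (x := t / 3)
    calc 1 - t ^ 2 / 16 ≤ (1 - (t / 3) ^ 2 / 2) * (1 - (t / 3) ^ 2 / 16) := by
          nlinarith [sq_nonneg (t ^ 2)]
      _ ≤ _ := mul_le_mul h2 h1 (by nlinarith) (by nlinarith)

/-- The function `F(t) = ∏_{k=1}^∞ cos(t/3^k)` has no limit as `t → +∞`: there is no real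
number `L` with `F(t) → L`. In particular `F` does not converge to `0`, so the central spin
with couplings `A_k = 1/3^k` never fully dephases. -/
theorem dephasing_no_limit_atTop (F : ℝ → ℝ)
    (hF : ∀ t : ℝ, Tendsto (fun N : ℕ => ∏ k ∈ Finset.range N, Real.cos (t / 3 ^ (k + 1)))
      atTop (nhds (F t))) :
    ¬ ∃ L : ℝ, Tendsto F atTop (nhds L) := by
  rintro ⟨L, hL⟩
  have hpos : 0 < F π := by
    have hpi : π ^ 2 < 16 := by nlinarith [Real.pi_lt_four, Real.pi_pos]
    have h := ge_of_tendsto' (hF π) fun N => one_sub_sq_div_le_prod_cos N π hpi.le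
    linarith
  have hmul (t : ℝ) : F (3 * t) = Real.cos t * F t := by
    refine tendsto_nhds_unique ((tendsto_add_atTop_iff_nat 1).2 (hF (3 * t))) ?_
    simp only [prod_cos_div_three_pow_succ, mul_div_cancel_left₀ t (three_ne_zero' ℝ)]
    exact (hF t).const_mul _
  have hstep (n : ℕ) : F (3 ^ (n + 1) * π) = -F (3 ^ n * π) := by
    have hcos : Real.cos (3 ^ n * π) = -1 := by
      have h := Real.cos_nat_mul_pi (3 ^ n)
      rw [(Odd.pow (by decide : Odd 3)).neg_one_pow] at h
      exact_mod_cast h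
    rw [pow_succ', mul_assoc, hmul, hcos, neg_one_mul]
  have hsq (n : ℕ) : F (3 ^ n * π) ^ 2 = F π ^ 2 := by
    induction n with
    | zero => simp
    | succ n ih => rw [hstep, neg_sq, ih]
  have hlim : Tendsto (fun n : ℕ => F (3 ^ n * π)) atTop (nhds L) :=
    hL.comp ((tendsto_pow_atTop_atTop_of_one_lt (by norm_num : (1 : ℝ) < 3)).atTop_mul_const
      Real.pi_pos)
  have hneg : L = -L := by
    refine tendsto_nhds_unique ((tendsto_add_atTop_iff_nat 1).2 hlim) ?_
    simp only [hstep]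
    exact hlim.neg
  have hLsq : L ^ 2 = F π ^ 2 := by
    refine tendsto_nhds_unique (hlim.pow 2) ?_
    simp only [hsq]
    exact tendsto_const_nhds
  have hL0 : L = 0 := by linarith
  rw [hL0] at hLsq
  nlinarith
end

section
/- For every integer n ≥ 3, the function F_n(t) = ∏_{k=1}^∞ cos(t/n^k) does not tend to 0 as t → +∞: it is not the case that F_n(t) → 0 as t → +∞. -/
open Filter Real

/-- Partial products of `cos (π / n ^ k)` lie in `[1 - (π² / 16) (1 - 9⁻ᴺ), 1]` for `n ≥ 3`. -/
lemma prod_cos_pi_div_pow_bounds {n : ℕ} (hn : 3 ≤ n) (N : ℕ) :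
    1 - π ^ 2 / 16 * (1 - 1 / 9 ^ N) ≤
        ∏ k ∈ Finset.range N, Real.cos (π / (n : ℝ) ^ (k + 1)) ∧
      ∏ k ∈ Finset.range N, Real.cos (π / (n : ℝ) ^ (k + 1)) ≤ 1 := by
  induction N with
  | zero => simp
  | succ N ih =>
    rw [Finset.prod_range_succ]
    set P := ∏ k ∈ Finset.range N, Real.cos (π / (n : ℝ) ^ (k + 1))
    set x := π / (n : ℝ) ^ (N + 1) with hx
    obtain ⟨hlow, hup⟩ := ih
    have hn' : (3 : ℝ) ≤ n := by exact_mod_cast hn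
    have hq : (0 : ℝ) < 1 / 9 ^ N := by positivity
    have hpi : π ^ 2 < 16 := by nlinarith [pi_pos, pi_lt_four]
    have hP : 0 ≤ P := by nlinarith [sq_nonneg π]
    have hx2 : x ^ 2 ≤ π ^ 2 * (1 / 9 ^ N) / 9 := by
      have hle : x ≤ π / 3 ^ (N + 1) := by
        rw [hx]
        gcongr
      calc x ^ 2 ≤ (π / 3 ^ (N + 1)) ^ 2 := by gcongr
        _ = π ^ 2 * (1 / 9 ^ N) / 9 := by
          rw [div_pow, ← pow_mul, mul_comm (N + 1) 2, pow_mul]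
          norm_num [pow_succ]
          field_simp
    have hcos := one_sub_sq_div_two_le_cos (x := x)
    have hpow : (1 : ℝ) / 9 ^ (N + 1) = 1 / 9 ^ N / 9 := by rw [pow_succ, div_div]
    constructor
    · rw [hpow]
      nlinarith [mul_le_mul_of_nonneg_left hcos hP,
        mul_le_mul_of_nonneg_right hup (sq_nonneg x)]
    · exact (mul_le_of_le_one_right hP (cos_le_one x)).trans hup

/-- For every integer `n ≥ 3`, the function `F_n(t) = ∏_{k=1}^∞ cos(t/n^k)` does not tend
to `0` as `t → +∞`. -/
theorem dephasing_not_tendsto_zero (n : ℕ) (hn : 3 ≤ n) (F : ℝ → ℝ)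
    (hF : ∀ t : ℝ, Tendsto (fun N : ℕ => ∏ k ∈ Finset.range N, Real.cos (t / (n : ℝ) ^ (k + 1)))
      atTop (nhds (F t))) :
    ¬ Tendsto F atTop (nhds 0) := by
  intro h
  have hn1 : (1 : ℝ) < n := by exact_mod_cast (by omega : 1 < n)
  have hscale (t : ℝ) : F (n * t) = F t * cos t := by
    refine tendsto_nhds_unique ((tendsto_add_atTop_iff_nat 1).2 (hF (n * t))) ?_
    refine ((hF t).mul_const (cos t)).congr fun N => ?_
    have hn0 : (n : ℝ) ≠ 0 := by positivity
    rw [Finset.prod_range_succ']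
    congr 1
    · refine Finset.prod_congr rfl fun k _ => ?_
      rw [pow_succ _ (k + 1), mul_comm (n : ℝ) t, mul_div_mul_right _ _ hn0]
    · rw [zero_add, pow_one, mul_div_cancel_left₀ _ hn0]
  have habs (m : ℕ) : |F (n ^ m * π)| = |F π| := by
    induction m with
    | zero => simp
    | succ m ih =>
      have hcos : |cos ((n : ℝ) ^ m * π)| = 1 := by
        simpa using abs_cos_int_mul_pi ((n : ℤ) ^ m)
      rw [pow_succ', mul_assoc, hscale, abs_mul, ih, hcos, mul_one]
  have hpos : 1 - π ^ 2 / 16 ≤ F π := by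
    refine ge_of_tendsto' (hF π) fun N => le_trans ?_ (prod_cos_pi_div_pow_bounds hn N).1
    have : 0 ≤ π ^ 2 / 16 * (1 / 9 ^ N) := by positivity
    linarith
  have hlim : Tendsto (fun m : ℕ => |F (n ^ m * π)|) atTop (nhds |0|) :=
    (h.comp ((tendsto_pow_atTop_atTop_of_one_lt hn1).atTop_mul_const pi_pos)).abs
  simp only [habs] at hlim
  have hzero : F π = 0 := by simpa using tendsto_nhds_unique tendsto_const_nhds hlim
  nlinarith [pi_pos, pi_lt_four]
end
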